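/- arXiv:1304.3524 — 4 statements merged into one kernel-verified Lean document; each statement's English description precedes it below -/
import Mathlib

section
/- A finite simple connected graph G with at least one edge has exactly one Q-main eigenvalue if and only if G is regular (all vertices have the same degree). -/
open Finset

variable {V : Type*}

/-- The signless Laplacian matrix `Q(G) = D(G) + A(G)` of a simple graph. -/
noncomputable def signlessLaplacian [Fintype V] [DecidableEq V] (G : SimpleGraph V)
    [DecidableRel G.Adj] : Matrix V V ℝ :=
  Matrix.diagonal (fun v => (G.degree v : ℝ)) + G.adjMatrix ℝ

/-- `μ` is a `Q`-main eigenvalue of `G` if it has an eigenvector of `Q(G)` whose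
entry sum is nonzero. -/
def IsQMainEigenvalue [Fintype V] [DecidableEq V] (G : SimpleGraph V)
    [DecidableRel G.Adj] (μ : ℝ) : Prop :=
  ∃ x : V → ℝ, (signlessLaplacian G).mulVec x = μ • x ∧ ∑ v, x v ≠ 0

/-- If every real eigenvector of a Hermitian matrix `A` not orthogonal to `w` has eigenvalue `μ`,
then `w` itself is fixed by `A` up to the factor `μ`. -/
theorem Matrix.IsHermitian.mulVec_eq_smul_of_forall_eigenvector [Fintype V] [DecidableEq V]
    {A : Matrix V V ℝ} (hA : A.IsHermitian) {w : V → ℝ} {μ : ℝ}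
    (h : ∀ (ν : ℝ) (x : V → ℝ), A.mulVec x = ν • x → x ⬝ᵥ w ≠ 0 → ν = μ) :
    A.mulVec w = μ • w := by
  have key : ∀ j, ⇑(hA.eigenvectorBasis j) ⬝ᵥ (A.mulVec w - μ • w) = 0 := by
    intro j
    have hj := hA.mulVec_eigenvectorBasis j
    have hAt : A.transpose = A := by simpa [Matrix.IsHermitian] using hA
    rw [dotProduct_sub, Matrix.dotProduct_mulVec, ← Matrix.mulVec_transpose, hAt, hj,
      smul_dotProduct, dotProduct_smul, ← sub_smul, smul_eq_mul, mul_eq_zero, sub_eq_zero]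
    by_contra! hne
    exact hne.1 (h _ _ hj hne.2)
  have hz : WithLp.toLp 2 (A.mulVec w - μ • w) = (0 : EuclideanSpace ℝ V) := by
    refine InnerProductSpace.ext_inner_left_basis hA.eigenvectorBasis.toBasis fun j => ?_
    simpa [EuclideanSpace.inner_eq_star_dotProduct, dotProduct_comm] using key j
  exact sub_eq_zero.mp ((WithLp.toLp_eq_zero 2).mp hz)

theorem signlessLaplacian_isHermitian [Fintype V] [DecidableEq V] (G : SimpleGraph V)
    [DecidableRel G.Adj] : (signlessLaplacian G).IsHermitian := by
  unfold signlessLaplacian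
  refine (Matrix.isHermitian_diagonal _).add ?_
  simp [Matrix.IsHermitian]

theorem signlessLaplacian_mulVec_one [Fintype V] [DecidableEq V] (G : SimpleGraph V)
    [DecidableRel G.Adj] :
    (signlessLaplacian G).mulVec 1 = fun v => 2 * (G.degree v : ℝ) := by
  ext v
  simp [signlessLaplacian, Matrix.add_mulVec, Matrix.mulVec_diagonal, two_mul]

theorem IsQMainEigenvalue.eq_two_mul_of_isRegularOfDegree [Fintype V] [DecidableEq V]
    {G : SimpleGraph V} [DecidableRel G.Adj] {d : ℕ} (hd : G.IsRegularOfDegree d) {μ : ℝ}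
    (hμ : IsQMainEigenvalue G μ) : μ = 2 * d := by
  obtain ⟨x, hx, hsum⟩ := hμ
  have hQt : (signlessLaplacian G).transpose = signlessLaplacian G := by
    simpa [Matrix.IsHermitian] using signlessLaplacian_isHermitian G
  have hdot : (signlessLaplacian G).mulVec 1 ⬝ᵥ x = 1 ⬝ᵥ (signlessLaplacian G).mulVec x := by
    rw [Matrix.dotProduct_mulVec, ← Matrix.mulVec_transpose, hQt]
  rw [hx, signlessLaplacian_mulVec_one] at hdot
  simp only [hd.degree_eq, dotProduct, Pi.one_apply, one_mul, Pi.smul_apply, smul_eq_mul,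
    ← Finset.mul_sum] at hdot
  exact (mul_right_cancel₀ hsum hdot).symm

/-- A finite simple connected graph with at least one edge has exactly one
`Q`-main eigenvalue iff it is regular. -/
theorem exactly_one_QMain_iff_regular [Fintype V] [DecidableEq V] (G : SimpleGraph V)
    [DecidableRel G.Adj] (hconn : G.Connected) (hedge : G.edgeSet.Nonempty) :
    {μ : ℝ | IsQMainEigenvalue G μ}.ncard = 1 ↔ ∃ d : ℕ, G.IsRegularOfDegree d := by
  have := hconn.nonempty
  constructor
  · intro hcard
    obtain ⟨μ, hμ⟩ := Set.ncard_eq_one.mp hcard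
    have hone := (signlessLaplacian_isHermitian G).mulVec_eq_smul_of_forall_eigenvector
      (w := 1) (μ := μ) fun ν x hx hsum => by
        have hν : ν ∈ {μ : ℝ | IsQMainEigenvalue G μ} := ⟨x, hx, by simpa [dotProduct] using hsum⟩
        simpa [hμ] using hν
    rw [signlessLaplacian_mulVec_one] at hone
    have hdeg : ∀ v, 2 * (G.degree v : ℝ) = μ := fun v => by simpa using congrFun hone v
    obtain ⟨v₀⟩ := this
    refine ⟨G.degree v₀, fun v => ?_⟩
    exact_mod_cast mul_left_cancel₀ two_ne_zero ((hdeg v).trans (hdeg v₀).symm)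
  · rintro ⟨d, hd⟩
    refine Set.ncard_eq_one.mpr ⟨2 * d, Set.eq_singleton_iff_unique_mem.mpr
      ⟨⟨1, ?_, by simp⟩, fun μ hμ => hμ.eq_two_mul_of_isRegularOfDegree hd⟩⟩
    ext v
    simp [signlessLaplacian_mulVec_one, hd.degree_eq]
end

section
/- Let a, b be integers, G ∈ 𝒢_{a,b}, and let P = u_0 u_1 ⋯ u_k be an internal path or an internal cycle in G. Then k ≤ 3. -/
open Finset
open scoped Classical

variable {V : Type*}

/-- `G ∈ 𝒢_{a,b}`: `G` is connected with at least one edge, and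
`∑_{u ∈ N(v)} d(u) = a·d(v) + b − d(v)²` for every vertex `v`. -/
def memClassG [Fintype V] (G : SimpleGraph V) (a b : ℤ) : Prop :=
  G.Connected ∧ G.edgeSet.Nonempty ∧
    ∀ v : V, (∑ u ∈ G.neighborFinset v, (G.degree u : ℤ)) =
      a * (G.degree v : ℤ) + b - (G.degree v : ℤ) ^ 2

/-- An internal path (or internal cycle, when `p 0 = p k`) of `G`: a path
`p 0, p 1, …, p k` (`k ≥ 1`), with all vertices distinct except possibly `p 0 = p k`
(which forces `k ≥ 3`), whose endpoints have degree at least `3` and whose internal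
vertices have degree `2`. -/
def IsInternalPath [Fintype V] (G : SimpleGraph V) (p : ℕ → V) (k : ℕ) : Prop :=
  1 ≤ k ∧ (∀ i < k, G.Adj (p i) (p (i + 1))) ∧
    (∀ i ≤ k, ∀ j ≤ k, p i = p j → i = j ∨ (i = 0 ∧ j = k) ∨ (i = k ∧ j = 0)) ∧
    (p 0 = p k → 3 ≤ k) ∧
    3 ≤ G.degree (p 0) ∧ 3 ≤ G.degree (p k) ∧
    ∀ i, 0 < i → i < k → G.degree (p i) = 2

/-- The neighbors of a vertex of degree `2` are any two distinct vertices adjacent to it. -/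
theorem sum_degree_neighborFinset_of_degree_eq_two [Fintype V] (G : SimpleGraph V) {v x y : V}
    (hv : G.degree v = 2) (hx : G.Adj v x) (hy : G.Adj v y) (hxy : x ≠ y) :
    (∑ u ∈ G.neighborFinset v, (G.degree u : ℤ)) = G.degree x + G.degree y := by
  have h : ({x, y} : Finset V) = G.neighborFinset v := by
    apply Finset.eq_of_subset_of_card_le
    · intro z hz
      simp only [Finset.mem_insert, Finset.mem_singleton] at hz
      rcases hz with rfl | rfl <;> simpa
    · rw [G.card_neighborFinset_eq_degree, hv, Finset.card_pair hxy]
  rw [← h, Finset.sum_pair hxy]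

/-- In a graph of `𝒢_{a,b}`, every internal path or internal cycle has length at most `3`. -/
theorem internalPath_length_le_three [Fintype V] (G : SimpleGraph V) (a b : ℤ)
    (hG : memClassG G a b) (p : ℕ → V) (k : ℕ) (hp : IsInternalPath G p k) :
    k ≤ 3 := by
  obtain ⟨-, -, hsum⟩ := hG
  obtain ⟨-, hadj, hinj, -, h0, -, hdeg⟩ := hp
  by_contra! hk
  have d1 := hdeg 1 (by omega) (by omega)
  have d2 := hdeg 2 (by omega) (by omega)
  have d3 := hdeg 3 (by omega) (by omega)
  have n02 : p 0 ≠ p 2 := fun h => by have := hinj 0 (by omega) 2 (by omega) h; omega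
  have n13 : p 1 ≠ p 3 := fun h => by have := hinj 1 (by omega) 3 (by omega) h; omega
  have s1 := sum_degree_neighborFinset_of_degree_eq_two G d1
    (hadj 0 (by omega)).symm (hadj 1 (by omega)) n02
  have s2 := sum_degree_neighborFinset_of_degree_eq_two G d2
    (hadj 1 (by omega)).symm (hadj 2 (by omega)) n13
  rw [hsum, d1, d2] at s1
  rw [hsum, d1, d2, d3] at s2
  omega
end

section
/- Let a, b be integers, G ∈ 𝒢_{a,b}, and let P = u_0 u_1 u_2 u_3 be an internal path or an internal cycle of length 3 in G. Then G contains no internal path v_0 v_1 v_2 of length 2 with d(v_0) = d(v_2) = d(u_0). -/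
open Finset
open scoped Classical

variable {V : Type*}

/-- If a graph of `𝒢_{a,b}` has an internal path or internal cycle of length `3`, then it
has no internal path `q 0, q 1, q 2` of length `2` with `d(q 0) = d(q 2) = d(p 0)`. -/
theorem no_internal_path_of_length_two [Fintype V] (G : SimpleGraph V) (a b : ℤ)
    (hG : memClassG G a b) (p : ℕ → V) (hp : IsInternalPath G p 3) :
    ¬ ∃ q : ℕ → V, IsInternalPath G q 2 ∧
        G.degree (q 0) = G.degree (p 0) ∧ G.degree (q 2) = G.degree (p 0) := by
  rintro ⟨q, ⟨-, hqadj, -, hqne, -, -, hqdeg⟩, hq0, hq2⟩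
  obtain ⟨-, hpadj, hpinj, -, hp0, -, hpdeg⟩ := hp
  have hp1 : G.degree (p 1) = 2 := hpdeg 1 (by norm_num) (by norm_num)
  have hp2 : G.degree (p 2) = 2 := hpdeg 2 (by norm_num) (by norm_num)
  have hq1 : G.degree (q 1) = 2 := hqdeg 1 (by norm_num) (by norm_num)
  have hpne : p 0 ≠ p 2 := fun h => by
    have := hpinj 0 (by norm_num) 2 (by norm_num) h
    omega
  have hqne' : q 0 ≠ q 2 := fun h => absurd (hqne h) (by norm_num)
  have hp_sum := sum_degree_neighborFinset_of_degree_eq_two G hp1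
    (hpadj 0 (by norm_num)).symm (hpadj 1 (by norm_num)) hpne
  have hq_sum := sum_degree_neighborFinset_of_degree_eq_two G hq1
    (hqadj 0 (by norm_num)).symm (hqadj 1 (by norm_num)) hqne'
  rw [hG.2.2, hp1, hp2] at hp_sum
  rw [hG.2.2, hq1, hq0, hq2] at hq_sum
  omega
end

section
/- Let a, b be integers, G ∈ 𝒢_{a,b}, and let P = u_0 u_1 u_2 u_3 be an internal path or an internal cycle of length 3 in G. Then d(u_0) = d(u_3). Moreover, if P' = v_0 v_1 v_2 v_3 is another internal path of length 3 in G, then d(v_0) = d(v_3) = d(u_0) = d(u_3). -/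
open Finset
open scoped Classical

variable {V : Type*}

/-- In a graph of `𝒢_{a,b}`, if a vertex of degree `2` has a neighbor of degree `2`, then its
other neighbor has degree `2a + b - 6`. -/
lemma degree_eq_of_adj_of_degree_eq_two [Fintype V] {G : SimpleGraph V} {a b : ℤ}
    (hG : memClassG G a b) {v x y : V} (hx : G.Adj v x) (hy : G.Adj v y) (hxy : x ≠ y)
    (hv : G.degree v = 2) (hdy : G.degree y = 2) : (G.degree x : ℤ) = 2 * a + b - 6 := by
  have hN : G.neighborFinset v = {x, y} := by
    symm
    apply Finset.eq_of_subset_of_card_le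
    · intro z hz
      rcases Finset.mem_insert.1 hz with rfl | hz
      · simpa using hx
      · rw [Finset.mem_singleton.1 hz]
        simpa using hy
    · rw [Finset.card_pair hxy, G.card_neighborFinset_eq_degree, hv]
  have h := hG.2.2 v
  rw [hN, Finset.sum_pair hxy, hv, hdy] at h
  push_cast at h
  linarith

/-- In a graph of `𝒢_{a,b}`, both endpoints of an internal path of length `3` have degree
`2a + b - 6`. -/
lemma IsInternalPath.degree_endpoints [Fintype V] {G : SimpleGraph V} {a b : ℤ}
    (hG : memClassG G a b) {p : ℕ → V} (hp : IsInternalPath G p 3) :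
    (G.degree (p 0) : ℤ) = 2 * a + b - 6 ∧ (G.degree (p 3) : ℤ) = 2 * a + b - 6 := by
  obtain ⟨-, hadj, hinj, -, -, -, hdeg⟩ := hp
  have h1 : G.degree (p 1) = 2 := hdeg 1 (by norm_num) (by norm_num)
  have h2 : G.degree (p 2) = 2 := hdeg 2 (by norm_num) (by norm_num)
  have h02 : p 0 ≠ p 2 := fun h => by
    have := hinj 0 (by norm_num) 2 (by norm_num) h
    omega
  have h31 : p 3 ≠ p 1 := fun h => by
    have := hinj 3 (by norm_num) 1 (by norm_num) h
    omega
  have h12 : G.Adj (p 1) (p 2) := hadj 1 (by norm_num)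
  exact ⟨degree_eq_of_adj_of_degree_eq_two hG (hadj 0 (by norm_num)).symm h12 h02 h1 h2,
    degree_eq_of_adj_of_degree_eq_two hG (hadj 2 (by norm_num)) h12.symm h31 h2 h1⟩

/-- If a graph of `𝒢_{a,b}` has an internal path or internal cycle `p` of length `3`, then
`d(p 0) = d(p 3)`; moreover for any other internal path `q` of length `3` one has
`d(q 0) = d(q 3) = d(p 0) = d(p 3)`. -/
theorem internal_path_length_three_endpoints [Fintype V] (G : SimpleGraph V) (a b : ℤ)
    (hG : memClassG G a b) (p : ℕ → V) (hp : IsInternalPath G p 3) :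
    G.degree (p 0) = G.degree (p 3) ∧
      ∀ q : ℕ → V, IsInternalPath G q 3 → q 0 ≠ q 3 →
        G.degree (q 0) = G.degree (p 0) ∧ G.degree (q 3) = G.degree (p 3) := by
  obtain ⟨hp0, hp3⟩ := hp.degree_endpoints hG
  refine ⟨by omega, fun q hq _ => ?_⟩
  obtain ⟨hq0, hq3⟩ := hq.degree_endpoints hG
  omega
end
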